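/- Let n ≥ 2, 0 < λ ≤ Λ, and ñ = (λ/Λ)(n−1) + 1. Let u : closure of ℝⁿ₊ → [0,∞) be lower semicontinuous and satisfy M⁺_{λ,Λ}(D²u) ≤ 0 in the viscosity sense in ℝⁿ₊, and define m_u(r) = inf { u(x)/xₙ : x ∈ ℝⁿ₊, |x| < r } for r > 0. Then the function r ↦ r^{ñ} m_u(r) is nondecreasing on (0, ∞). -/

import Mathlib

open scoped BigOperators

/-- The Pucci maximal operator `M⁺_{λ,Λ}`: for a symmetric matrix it equals
`Λ · (sum of positive eigenvalues) + λ · (sum of negative eigenvalues)`. -/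
noncomputable def pucciMax (lam Lam : ℝ) {n : ℕ} (M : Matrix (Fin n) (Fin n) ℝ) : ℝ :=
  if h : M.IsHermitian then
    ∑ i, (Lam * max (h.eigenvalues i) 0 + lam * min (h.eigenvalues i) 0)
  else 0

/-- The Hessian matrix of `φ` at `x`. -/
noncomputable def hess {n : ℕ} (φ : EuclideanSpace ℝ (Fin n) → ℝ)
    (x : EuclideanSpace ℝ (Fin n)) : Matrix (Fin n) (Fin n) ℝ :=
  fun i j => iteratedFDeriv ℝ 2 φ x ![EuclideanSpace.single i 1, EuclideanSpace.single j 1]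

/-- `u` is a viscosity supersolution of `M⁺_{λ,Λ}(D²u) + g = 0` in `Ω`. -/
def PucciSupersol (lam Lam : ℝ) {n : ℕ} (Ω : Set (EuclideanSpace ℝ (Fin n)))
    (u g : EuclideanSpace ℝ (Fin n) → ℝ) : Prop :=
  ∀ x₀ ∈ Ω, ∀ φ : EuclideanSpace ℝ (Fin n) → ℝ, ContDiff ℝ 2 φ →
    IsLocalMin (fun x => u x - φ x) x₀ → pucciMax lam Lam (hess φ x₀) + g x₀ ≤ 0

open Filter Topology Matrix

lemma le_pucciMax {n : ℕ} {lam Lam : ℝ} (hLam : lam ≤ Lam) {M : Matrix (Fin n) (Fin n) ℝ}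
    (hM : M.IsHermitian) (x : EuclideanSpace ℝ (Fin n)) (hx : ‖x‖ ^ 2 ≠ 0) :
    lam * M.trace + (Lam - lam) * ((∑ i, ∑ j, x i * M i j * x j) / ‖x‖ ^ 2) ≤
      pucciMax lam Lam M := by
  have hpos : 0 < ‖x‖ ^ 2 := lt_of_le_of_ne (by positivity) hx.symm
  set b := hM.eigenvectorBasis with hb
  have hquad : ∑ i, ∑ j, x i * M i j * x j =
      ∑ i, hM.eigenvalues i * inner ℝ (b i) x ^ 2 := by
    have h1 : ∑ i, ∑ j, x i * M i j * x j = inner ℝ (WithLp.toLp 2 (M *ᵥ x.ofLp)) x := by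
      simp only [PiLp.inner_apply, Matrix.mulVec, dotProduct, RCLike.inner_apply, conj_trivial,
        Finset.mul_sum]
      exact Finset.sum_congr rfl fun i _ => Finset.sum_congr rfl fun j _ => by ring
    rw [h1, ← b.sum_inner_mul_inner]
    refine Finset.sum_congr rfl fun i _ => ?_
    have h2 : inner ℝ (WithLp.toLp 2 (M *ᵥ x.ofLp)) (b i) =
        hM.eigenvalues i * inner ℝ (b i) x := by
      have h3 : inner ℝ (WithLp.toLp 2 (M *ᵥ x.ofLp)) (b i) =
          inner ℝ x (WithLp.toLp 2 (M *ᵥ (b i).ofLp)) := by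
        have hsymm := Matrix.isSymmetric_toEuclideanLin_iff.mpr hM x (b i)
        simpa [Matrix.toLpLin_apply] using hsymm
      rw [h3, hb, hM.mulVec_eigenvectorBasis, ← hb, WithLp.toLp_smul, inner_smul_right,
        real_inner_comm]
    rw [h2]; ring
  have hle : ∀ i, inner ℝ (b i) x ^ 2 ≤ ‖x‖ ^ 2 := fun i => by
    have := abs_real_inner_le_norm (b i) x
    rw [b.orthonormal.1 i, one_mul] at this
    exact sq_le_sq' (abs_le.mp this).1 (abs_le.mp this).2
  have hq : (∑ i, ∑ j, x i * M i j * x j) / ‖x‖ ^ 2 ≤ ∑ i, max (hM.eigenvalues i) 0 := by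
    rw [div_le_iff₀ hpos, hquad, Finset.sum_mul]
    refine Finset.sum_le_sum fun i _ => ?_
    calc hM.eigenvalues i * inner ℝ (b i) x ^ 2
        ≤ max (hM.eigenvalues i) 0 * inner ℝ (b i) x ^ 2 := by
          gcongr; exact le_max_left _ _
      _ ≤ _ := mul_le_mul_of_nonneg_left (hle i) (le_max_right _ _)
  have hp : pucciMax lam Lam M =
      lam * M.trace + (Lam - lam) * ∑ i, max (hM.eigenvalues i) 0 := by
    rw [pucciMax, dif_pos hM, hM.trace_eq_sum_eigenvalues, Finset.mul_sum, Finset.mul_sum,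
      ← Finset.sum_add_distrib]
    refine Finset.sum_congr rfl fun i _ => ?_
    have := min_add_max (hM.eigenvalues i) 0
    simp only [RCLike.ofReal_real_eq_id, id]
    linear_combination lam * this
  rw [hp]
  have := mul_le_mul_of_nonneg_left hq (sub_nonneg.mpr hLam)
  linarith

/-- The half-space barrier `xₖ (κ |x|^{-2p} - q)`. -/
noncomputable def barrier {n : ℕ} (k : Fin n) (κ p q : ℝ) (y : EuclideanSpace ℝ (Fin n)) : ℝ :=
  y k * (κ * (‖y‖ ^ 2) ^ (-p) - q)

lemma contDiffAt_barrier {n : ℕ} (k : Fin n) (κ p q : ℝ) {x : EuclideanSpace ℝ (Fin n)}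
    (hx : x ≠ 0) : ContDiffAt ℝ 2 (barrier k κ p q) x := by
  have h0 : ‖x‖ ^ 2 ≠ 0 := by simpa using hx
  have hk : ContDiffAt ℝ 2 (fun y : EuclideanSpace ℝ (Fin n) => y k) x :=
    (EuclideanSpace.proj (𝕜 := ℝ) k).contDiff.contDiffAt
  have hr : ContDiffAt ℝ 2 (fun y : EuclideanSpace ℝ (Fin n) => (‖y‖ ^ 2) ^ (-p)) x :=
    (contDiff_norm_sq ℝ).contDiffAt.rpow_const_of_ne h0
  exact hk.mul ((contDiffAt_const.mul hr).sub contDiffAt_const)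

lemma hasFDerivAt_norm_sq_rpow {n : ℕ} (p : ℝ) {x : EuclideanSpace ℝ (Fin n)} (hx : x ≠ 0) :
    HasFDerivAt (fun y : EuclideanSpace ℝ (Fin n) => (‖y‖ ^ 2) ^ p)
      ((p * (‖x‖ ^ 2) ^ (p - 1)) • ((2 : ℝ) • innerSL ℝ x)) x := by
  have h0 : ‖x‖ ^ 2 ≠ 0 := by simpa using hx
  have h := (hasStrictFDerivAt_norm_sq x).hasFDerivAt.rpow_const (p := p) (Or.inl h0)
  have e : (2 : ℝ) • innerSL ℝ x = 2 • innerSL ℝ x := by rw [two_smul, two_smul]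
  rw [e]
  exact h

lemma fderiv_barrier {n : ℕ} (k : Fin n) (κ p q : ℝ) {y : EuclideanSpace ℝ (Fin n)}
    (hy : y ≠ 0) (w : EuclideanSpace ℝ (Fin n)) :
    fderiv ℝ (barrier k κ p q) y w =
      w k * (κ * (‖y‖ ^ 2) ^ (-p) - q) +
        (-2 * p * κ) * ((y k * (‖y‖ ^ 2) ^ (-p - 1)) * inner ℝ w y) := by
  have hk : HasFDerivAt (fun y : EuclideanSpace ℝ (Fin n) => y k)
      (EuclideanSpace.proj (𝕜 := ℝ) k) y := (EuclideanSpace.proj (𝕜 := ℝ) k).hasFDerivAt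
  have h := hk.mul (((hasFDerivAt_norm_sq_rpow (-p) hy).const_mul κ).sub_const q)
  have h' : HasFDerivAt (barrier k κ p q) _ y := h
  rw [h'.fderiv]
  simp only [_root_.add_apply, _root_.smul_apply, smul_eq_mul, innerSL_apply_apply,
    PiLp.proj_apply, real_inner_comm w y]
  ring

lemma fderiv_fderiv_barrier {n : ℕ} (k : Fin n) (κ p q : ℝ) {x : EuclideanSpace ℝ (Fin n)}
    (hx : x ≠ 0) (v w : EuclideanSpace ℝ (Fin n)) :
    fderiv ℝ (fderiv ℝ (barrier k κ p q)) x v w =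
      -2 * p * κ * (‖x‖ ^ 2) ^ (-p - 1) *
          (w k * inner ℝ v x + v k * inner ℝ w x + x k * inner ℝ v w) +
        4 * p * (p + 1) * κ * (‖x‖ ^ 2) ^ (-p - 2) * (x k * inner ℝ v x * inner ℝ w x) := by
  have hd : DifferentiableAt ℝ (fderiv ℝ (barrier k κ p q)) x :=
    ((contDiffAt_barrier k κ p q hx).fderiv_right (m := 1) (by norm_num)).differentiableAt
      (by norm_num)
  have h1 : fderiv ℝ (fderiv ℝ (barrier k κ p q)) x v w =
      fderiv ℝ (fun y => fderiv ℝ (barrier k κ p q) y w) x v := by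
    rw [fderiv_clm_apply hd (differentiableAt_const w)]; simp
  have h2 : (fun y => fderiv ℝ (barrier k κ p q) y w) =ᶠ[𝓝 x] fun y =>
      w k * (κ * (‖y‖ ^ 2) ^ (-p) - q) +
        (-2 * p * κ) * ((y k * (‖y‖ ^ 2) ^ (-p - 1)) * inner ℝ w y) := by
    filter_upwards [isOpen_ne.mem_nhds hx] with y hy using fderiv_barrier k κ p q hy w
  have hk : HasFDerivAt (fun y : EuclideanSpace ℝ (Fin n) => y k)
      (EuclideanSpace.proj (𝕜 := ℝ) k) x := (EuclideanSpace.proj (𝕜 := ℝ) k).hasFDerivAt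
  have hw : HasFDerivAt (fun y : EuclideanSpace ℝ (Fin n) => inner ℝ w y)
      (innerSL ℝ w) x := (innerSL ℝ w).hasFDerivAt
  have h3 := ((((hasFDerivAt_norm_sq_rpow (-p) hx).const_mul κ).sub_const q).const_mul
    (w k)).add (((hk.mul (hasFDerivAt_norm_sq_rpow (-p - 1) hx)).mul hw).const_mul (-2 * p * κ))
  have e : (-p - 1 - 1 : ℝ) = -p - 2 := by ring
  rw [h1, h2.fderiv_eq]
  refine (congrArg (fun T : EuclideanSpace ℝ (Fin n) →L[ℝ] ℝ => T v) h3.fderiv).trans ?_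
  simp only [_root_.add_apply, _root_.smul_apply, smul_eq_mul, innerSL_apply_apply,
    PiLp.proj_apply, Pi.mul_apply, real_inner_comm v x, real_inner_comm v w, e]
  ring

lemma hess_barrier {n : ℕ} (k : Fin n) (κ p q : ℝ) {x : EuclideanSpace ℝ (Fin n)}
    (hx : x ≠ 0) (i j : Fin n) :
    hess (barrier k κ p q) x i j =
      -2 * p * κ * (‖x‖ ^ 2) ^ (-p - 1) *
          ((if j = k then 1 else 0) * x i + (if i = k then 1 else 0) * x j +
            x k * (if i = j then 1 else 0)) +
        4 * p * (p + 1) * κ * (‖x‖ ^ 2) ^ (-p - 2) * (x k * x i * x j) := by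
  rw [hess, iteratedFDeriv_two_apply]
  simp only [Matrix.cons_val_zero, Matrix.cons_val_one]
  rw [fderiv_fderiv_barrier k κ p q hx]
  simp [EuclideanSpace.inner_single_left, eq_comm]

lemma pucciMax_hess_barrier_pos {n : ℕ} (k : Fin n) {lam Lam κ p : ℝ} (q : ℝ)
    (hLam : lam ≤ Lam) (hκ : 0 < κ) (hp : 0 < p)
    (hlt : lam * ((n : ℝ) - 1) < Lam * (2 * p - 1))
    {x : EuclideanSpace ℝ (Fin n)} (hx : 0 < x k) :
    0 < pucciMax lam Lam (hess (barrier k κ p q) x) := by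
  have hx0 : x ≠ 0 := by rintro rfl; simp at hx
  have h0 : ‖x‖ ^ 2 ≠ 0 := by simpa using hx0
  have hpos : 0 < ‖x‖ ^ 2 := lt_of_le_of_ne (by positivity) h0.symm
  have hM : (hess (barrier k κ p q) x).IsHermitian := by
    refine Matrix.IsHermitian.ext fun i j => ?_
    simp only [star_trivial, hess_barrier k κ p q hx0, eq_comm (a := j) (b := i)]
    ring
  refine lt_of_lt_of_le ?_ (le_pucciMax hLam hM x h0)
  have hsum : ∑ i, x i * x i = ‖x‖ ^ 2 := by
    rw [EuclideanSpace.real_norm_sq_eq]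
    exact Finset.sum_congr rfl fun i _ => (pow_two _).symm
  have hpow : (‖x‖ ^ 2) ^ (-p - 1) = (‖x‖ ^ 2) ^ (-p - 2) * ‖x‖ ^ 2 := by
    rw [← Real.rpow_add_one h0]; congr 1; ring
  set t := ‖x‖ ^ 2
  set A := t ^ (-p - 2)
  have hA : 0 < A := Real.rpow_pos_of_pos hpos _
  have htr : (hess (barrier k κ p q) x).trace = 2 * p * κ * (A * t) * x k * (2 * p - n) := by
    simp only [Matrix.trace, Matrix.diag_apply, hess_barrier k κ p q hx0]
    rw [Finset.sum_add_distrib, ← Finset.mul_sum, ← Finset.mul_sum]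
    simp only [Finset.sum_add_distrib, mul_assoc (x k), ← Finset.mul_sum, hsum]
    simp only [ite_mul, one_mul, zero_mul, Finset.sum_ite_eq', Finset.mem_univ, if_true,
      Finset.sum_const, Finset.card_univ, Fintype.card_fin, nsmul_eq_mul, mul_one]
    change -2 * p * κ * t ^ (-p - 1) * _ + 4 * p * (p + 1) * κ * A * _ = _
    rw [hpow]
    ring
  have hqf : ∑ i, ∑ j, x i * hess (barrier k κ p q) x i j * x j =
      2 * p * κ * (A * t) * x k * (2 * p - 1) * t := by
    have e : ∀ i, ∑ j, x i * hess (barrier k κ p q) x i j * x j =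
        (-2 * p * κ * (A * t)) * (2 * x k * (x i * x i) + (if i = k then x i * t else 0)) +
        4 * p * (p + 1) * κ * A * x k * t * (x i * x i) := by
      intro i
      have : ∀ j, x i * hess (barrier k κ p q) x i j * x j =
          (-2 * p * κ * (A * t)) * ((if j = k then x i * x i * x j else 0) +
            (if i = k then x i else 0) * (x j * x j) + (if i = j then x k * x i * x j else 0)) +
          4 * p * (p + 1) * κ * A * x k * (x i * x i) * (x j * x j) := by
        intro j
        rw [hess_barrier k κ p q hx0]
        change x i * (-2 * p * κ * t ^ (-p - 1) * _ + 4 * p * (p + 1) * κ * A * _) * x j = _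
        rw [hpow]
        split_ifs <;> ring
      simp only [this, Finset.sum_add_distrib, ← Finset.mul_sum, hsum, Finset.sum_ite_eq',
        Finset.sum_ite_eq, Finset.mem_univ, if_true]
      split_ifs <;> ring
    simp only [e, Finset.sum_add_distrib, ← Finset.mul_sum, hsum, Finset.sum_ite_eq',
      Finset.mem_univ, if_true]
    ring
  rw [htr, hqf, mul_div_assoc, div_self h0, mul_one]
  have hc : 0 < 2 * p * κ * (A * t) * x k := by positivity
  nlinarith [mul_pos hc (sub_pos.mpr hlt)]

lemma exists_contDiff_eventuallyEq {n : ℕ} {f : EuclideanSpace ℝ (Fin n) → ℝ}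
    (hf : ∀ x, x ≠ 0 → ContDiffAt ℝ 2 f x) {x₀ : EuclideanSpace ℝ (Fin n)} (hx₀ : x₀ ≠ 0) :
    ∃ φ : EuclideanSpace ℝ (Fin n) → ℝ, ContDiff ℝ 2 φ ∧ φ =ᶠ[𝓝 x₀] f := by
  have hpos : 0 < ‖x₀‖ := norm_pos_iff.mpr hx₀
  let b : ContDiffBump x₀ := ⟨‖x₀‖ / 4, ‖x₀‖ / 2, by positivity, by linarith⟩
  refine ⟨fun x => b x * f x, contDiff_iff_contDiffAt.mpr fun x => ?_, ?_⟩
  · by_cases hx : x = 0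
    · subst hx
      have h0 : (0 : EuclideanSpace ℝ (Fin n)) ∉ tsupport b := by
        rw [b.tsupport_eq, Metric.mem_closedBall, dist_zero_left]
        change ¬ ‖x₀‖ ≤ ‖x₀‖ / 2
        linarith
      have : (fun x => b x * f x) =ᶠ[𝓝 0] fun _ => 0 := by
        filter_upwards [notMem_tsupport_iff_eventuallyEq.mp h0] with y hy
        simp [hy]
      exact contDiffAt_const.congr_of_eventuallyEq this
    · exact b.contDiff.contDiffAt.mul (hf x hx)
  · filter_upwards [b.eventuallyEq_one] with y hy
    simp [hy]

lemma barrier_le_of_pucciSupersol {n : ℕ} (k : Fin n) {lam Lam : ℝ} (hLam : lam ≤ Lam)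
    {u : EuclideanSpace ℝ (Fin n) → ℝ} (hu : LowerSemicontinuousOn u {x | 0 ≤ x k})
    (hnonneg : ∀ x : EuclideanSpace ℝ (Fin n), 0 ≤ x k → 0 ≤ u x)
    (hsuper : PucciSupersol lam Lam {x | 0 < x k} u (fun _ => 0))
    {κ p q ρ R : ℝ} (hκ : 0 < κ) (hp : 0 < p) (hlt : lam * ((n : ℝ) - 1) < Lam * (2 * p - 1))
    (hρ : 0 < ρ)
    (hin : ∀ x : EuclideanSpace ℝ (Fin n), 0 < x k → ‖x‖ = ρ → barrier k κ p q x ≤ u x)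
    (hout : κ * (R ^ 2) ^ (-p) ≤ q)
    {x : EuclideanSpace ℝ (Fin n)} (hx : 0 < x k) (hxρ : ρ ≤ ‖x‖) (hxR : ‖x‖ ≤ R) :
    barrier k κ p q x ≤ u x := by
  set K : Set (EuclideanSpace ℝ (Fin n)) := {y | 0 ≤ y k ∧ ρ ≤ ‖y‖ ∧ ‖y‖ ≤ R}
  have hck : Continuous fun y : EuclideanSpace ℝ (Fin n) => y k :=
    (EuclideanSpace.proj (𝕜 := ℝ) k).continuous
  have hcl : IsClosed K := (isClosed_le continuous_const hck).inter
    ((isClosed_le continuous_const continuous_norm).inter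
      (isClosed_le continuous_norm continuous_const))
  have hcomp : IsCompact K := by
    refine (isCompact_closedBall (0 : EuclideanSpace ℝ (Fin n)) R).of_isClosed_subset hcl ?_
    intro y hy
    simpa using hy.2.2
  have hne0 : ∀ y ∈ K, y ≠ 0 := by
    rintro y hy rfl
    have := hy.2.1
    simp at this
    linarith
  have hlsc : LowerSemicontinuousOn (fun y => u y + -barrier k κ p q y) K := by
    refine (hu.mono fun y hy => hy.1).add (ContinuousOn.lowerSemicontinuousOn ?_)
    exact fun y hy =>
      (contDiffAt_barrier k κ p q (hne0 y hy)).continuousAt.neg.continuousWithinAt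
  obtain ⟨z, hz, hmin⟩ := LowerSemicontinuousOn.exists_isMinOn (⟨x, hx.le, hxρ, hxR⟩ : K.Nonempty) hcomp hlsc
  have hzx := isMinOn_iff.mp hmin x ⟨hx.le, hxρ, hxR⟩
  by_contra! hcon
  have hneg : u z < barrier k κ p q z := by linarith
  have hzk : 0 < z k := by
    refine lt_of_le_of_ne hz.1 fun h => ?_
    have := hnonneg z hz.1
    rw [barrier, ← h] at hneg
    linarith
  have hzρ : ρ < ‖z‖ := lt_of_le_of_ne hz.2.1 fun h => (hin z hzk h.symm).not_gt hneg
  have hzR : ‖z‖ < R := by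
    refine lt_of_le_of_ne hz.2.2 fun h => ?_
    have h1 := hnonneg z hz.1
    have h2 : barrier k κ p q z ≤ 0 := by
      rw [barrier, h]
      exact mul_nonpos_of_nonneg_of_nonpos hz.1 (sub_nonpos.mpr hout)
    linarith
  obtain ⟨φ, hφ, hφeq⟩ := exists_contDiff_eventuallyEq
    (fun y hy => contDiffAt_barrier k κ p q hy) (hne0 z hz)
  have hKz : K ∈ 𝓝 z := by
    filter_upwards [(isOpen_lt continuous_const hck).mem_nhds hzk,
      (isOpen_lt continuous_const continuous_norm).mem_nhds hzρ,
      (isOpen_lt continuous_norm continuous_const).mem_nhds hzR] with y h1 h2 h3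
    exact ⟨h1.le, h2.le, h3.le⟩
  have hloc : IsLocalMin (fun y => u y - φ y) z := by
    filter_upwards [hφeq, hKz] with y hy hyK
    have := isMinOn_iff.mp hmin y hyK
    rw [hy, hφeq.self_of_nhds]
    linarith
  have hle := hsuper z hzk φ hφ hloc
  have hhess : hess φ z = hess (barrier k κ p q) z := by
    ext i j
    simp only [hess, (hφeq.iteratedFDeriv ℝ 2).self_of_nhds]
  have := pucciMax_hess_barrier_pos k q hLam hκ hp hlt hzk
  rw [hhess] at hle
  linarith

lemma barrier_eq {n : ℕ} (k : Fin n) (κ p q : ℝ) (x : EuclideanSpace ℝ (Fin n)) :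
    barrier k κ p q x = x k * (κ * ‖x‖ ^ (-(2 * p)) - q) := by
  rw [barrier, ← Real.rpow_natCast_mul (norm_nonneg x)]
  congr 4
  push_cast; ring

/-- Growth estimate outside a half ball on which `u ≥ c xₖ`. -/
lemma mul_rpow_div_norm_le {n : ℕ} (k : Fin n) {lam Lam nt : ℝ} (hlam : 0 < lam)
    (hLam : lam ≤ Lam) (hnt : nt = lam / Lam * ((n : ℝ) - 1) + 1)
    {u : EuclideanSpace ℝ (Fin n) → ℝ} (hu : LowerSemicontinuousOn u {x | 0 ≤ x k})
    (hnonneg : ∀ x : EuclideanSpace ℝ (Fin n), 0 ≤ x k → 0 ≤ u x)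
    (hsuper : PucciSupersol lam Lam {x | 0 < x k} u (fun _ => 0))
    {c r : ℝ} (hc : 0 < c) (hr : 0 < r)
    (hin : ∀ x : EuclideanSpace ℝ (Fin n), 0 < x k → ‖x‖ < r → c * x k ≤ u x)
    {x : EuclideanSpace ℝ (Fin n)} (hx : 0 < x k) (hxr : r ≤ ‖x‖) :
    x k * (c * r ^ nt * ‖x‖ ^ (-nt)) ≤ u x := by
  have hn : (1 : ℝ) ≤ n := by exact_mod_cast k.pos
  have hL : 0 < Lam := hlam.trans_le hLam
  have hnt1 : 1 ≤ nt := by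
    have : 0 ≤ lam / Lam * ((n : ℝ) - 1) := mul_nonneg (by positivity) (by linarith)
    linarith
  have hx0 : 0 < ‖x‖ := hr.trans_le hxr
  have key : ∀ a > nt, ∀ ρ, 0 < ρ → ρ < r → ∀ R, ‖x‖ ≤ R →
      x k * (c * ρ ^ a * ‖x‖ ^ (-a) - c * ρ ^ a * R ^ (-a)) ≤ u x := by
    intro a ha ρ hρ hρr R hR
    have hR0 : 0 < R := hx0.trans_le hR
    have ha2 : 2 * (a / 2) = a := by ring
    have hlt : lam * ((n : ℝ) - 1) < Lam * (2 * (a / 2) - 1) := by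
      have : lam * ((n : ℝ) - 1) = Lam * (nt - 1) := by rw [hnt]; field_simp; ring
      rw [this, ha2]; gcongr
    have hκ : 0 < c * ρ ^ a := by positivity
    have h := barrier_le_of_pucciSupersol k hLam hu hnonneg hsuper (κ := c * ρ ^ a) (p := a / 2)
      (q := c * ρ ^ a * R ^ (-a)) (ρ := ρ) (R := R) hκ (by linarith) hlt hρ ?_ ?_ hx
      (hρr.le.trans hxr) hR
    · rwa [barrier_eq, ha2] at h
    · intro y hy hyρ
      refine le_trans ?_ (hin y hy (hyρ.trans_lt hρr))
      rw [barrier_eq, ha2, hyρ, mul_assoc, ← Real.rpow_add hρ, add_neg_cancel, Real.rpow_zero]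
      have : 0 ≤ c * ρ ^ a * R ^ (-a) := by positivity
      nlinarith
    · rw [← Real.rpow_natCast_mul hR0.le]
      apply le_of_eq; congr 2; push_cast; ring
  have keyR : ∀ a > nt, ∀ ρ, 0 < ρ → ρ < r → x k * (c * ρ ^ a * ‖x‖ ^ (-a)) ≤ u x := by
    intro a ha ρ hρ hρr
    have ht : Tendsto (fun R : ℝ => x k * (c * ρ ^ a * ‖x‖ ^ (-a) - c * ρ ^ a * R ^ (-a))) atTop
        (𝓝 (x k * (c * ρ ^ a * ‖x‖ ^ (-a) - c * ρ ^ a * 0))) :=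
      (((tendsto_rpow_neg_atTop (by linarith)).const_mul _).const_sub _).const_mul _
    rw [mul_zero, sub_zero] at ht
    exact le_of_tendsto ht ((eventually_ge_atTop ‖x‖).mono (key a ha ρ hρ hρr))
  have keyρ : ∀ a > nt, x k * (c * r ^ a * ‖x‖ ^ (-a)) ≤ u x := by
    intro a ha
    have hcont : ContinuousAt (fun ρ : ℝ => x k * (c * ρ ^ a * ‖x‖ ^ (-a))) r :=
      (((Real.continuousAt_rpow_const r a (Or.inl hr.ne')).const_mul c).mul_const _).const_mul _
    refine le_of_tendsto (hcont.tendsto.mono_left nhdsWithin_le_nhds : Tendsto _ (𝓝[<] r) _) ?_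
    filter_upwards [Ioo_mem_nhdsLT hr] with ρ hρ using keyR a ha ρ hρ.1 hρ.2
  have hcont : ContinuousAt (fun a : ℝ => x k * (c * r ^ a * ‖x‖ ^ (-a))) nt :=
    (((Real.continuousAt_const_rpow hr.ne').const_mul c).mul
      ((Real.continuousAt_const_rpow hx0.ne').comp continuousAt_neg)).const_mul _
  refine le_of_tendsto (hcont.tendsto.mono_left nhdsWithin_le_nhds : Tendsto _ (𝓝[>] nt) _) ?_
  filter_upwards [self_mem_nhdsWithin] with a ha using keyρ a ha

theorem stmt17 (n : ℕ) (hn : 2 ≤ n) (lam Lam : ℝ) (hlam : 0 < lam) (hLam : lam ≤ Lam)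
    (nt : ℝ) (hnt : nt = lam / Lam * ((n : ℝ) - 1) + 1)
    (u : EuclideanSpace ℝ (Fin n) → ℝ)
    (hu : LowerSemicontinuousOn u {x | 0 ≤ x ⟨n - 1, by omega⟩})
    (hnonneg : ∀ x : EuclideanSpace ℝ (Fin n), 0 ≤ x ⟨n - 1, by omega⟩ → 0 ≤ u x)
    (hsuper : PucciSupersol lam Lam {x | 0 < x ⟨n - 1, by omega⟩} u (fun _ => 0))
    (m : ℝ → ℝ)
    (hm : ∀ r : ℝ, m r = sInf ((fun x : EuclideanSpace ℝ (Fin n) => u x / x ⟨n - 1, by omega⟩) ''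
      {x : EuclideanSpace ℝ (Fin n) | 0 < x ⟨n - 1, by omega⟩ ∧ ‖x‖ < r})) :
    ∀ r s : ℝ, 0 < r → r ≤ s → r ^ nt * m r ≤ s ^ nt * m s := by
  intro r s hr hrs
  have hs : 0 < s := hr.trans_le hrs
  set k : Fin n := ⟨n - 1, by omega⟩
  have hnt0 : 0 ≤ nt := by
    have h1 : (1 : ℝ) ≤ n := by exact_mod_cast (by omega : 1 ≤ n)
    have : 0 ≤ lam / Lam * ((n : ℝ) - 1) :=
      mul_nonneg (div_nonneg hlam.le (hlam.le.trans hLam)) (by linarith)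
    linarith
  have hnn : ∀ ρ, ∀ y ∈ (fun x : EuclideanSpace ℝ (Fin n) => u x / x k) ''
      {x : EuclideanSpace ℝ (Fin n) | 0 < x k ∧ ‖x‖ < ρ}, 0 ≤ y := by
    rintro ρ _ ⟨x, hx, rfl⟩
    exact div_nonneg (hnonneg x hx.1.le) hx.1.le
  have hm0 : ∀ ρ, 0 ≤ m ρ := fun ρ => by
    rw [hm]; exact Real.sInf_nonneg (hnn ρ)
  rcases (hm0 r).eq_or_lt with h0 | hc
  · rw [← h0, mul_zero]
    exact mul_nonneg (by positivity) (hm0 s)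
  have hin : ∀ x : EuclideanSpace ℝ (Fin n), 0 < x k → ‖x‖ < r → m r * x k ≤ u x := by
    intro x hx hxr
    rw [← le_div_iff₀ hx, hm]
    exact csInf_le ⟨0, hnn r⟩ ⟨x, ⟨hx, hxr⟩, rfl⟩
  rw [mul_comm (s ^ nt), ← div_le_iff₀ (by positivity), hm s]
  refine le_csInf ⟨_, EuclideanSpace.single k (s / 2), ⟨?_, ?_⟩, rfl⟩ ?_
  · simpa using hs
  · simp only [PiLp.norm_single, Real.norm_eq_abs, abs_of_pos (half_pos hs)]
    linarith
  rintro _ ⟨x, ⟨hx, hxs⟩, rfl⟩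
  simp only
  rw [le_div_iff₀ hx]
  rcases lt_or_ge ‖x‖ r with hxr | hxr
  · refine le_trans ?_ (hin x hx hxr)
    gcongr
    rw [div_le_iff₀ (by positivity), mul_comm]
    gcongr
  · have hx0 : 0 < ‖x‖ := hr.trans_le hxr
    refine le_trans ?_ (mul_rpow_div_norm_le k hlam hLam hnt hu hnonneg hsuper hc hr hin hx hxr)
    rw [Real.rpow_neg hx0.le, mul_comm (x k), ← div_eq_mul_inv, mul_comm (m r)]
    gcongr
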